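/- Let f be an orientation preserving circle homeomorphism with a periodic point, and let n_f be its minimal period. If f^d is strongly reversible in Homeo(S¹) for some integer d ∈ {1,…,n_f−1} coprime to n_f, then f is strongly reversible in Homeo(S¹). -/

import Mathlib

noncomputable section

open scoped Classical

local instance : Fact ((0:ℝ) < 1) := ⟨zero_lt_one⟩

/-- The circle `S¹`, realised as `ℝ / ℤ`. -/
abbrev S1 := AddCircle (1 : ℝ)

/-- `F` is a (monotone, degree one) lift of the circle homeomorphism `f`. -/
def IsLiftOf (f : S1 ≃ₜ S1) (F : CircleDeg1Lift) : Prop :=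
  ∀ x : ℝ, f (x : S1) = ((F x : ℝ) : S1)

/-- A circle homeomorphism is orientation preserving iff it admits a monotone degree one lift. -/
def OrientationPreserving (f : S1 ≃ₜ S1) : Prop :=
  ∃ F : CircleDeg1Lift, IsLiftOf f F

/-- A circle homeomorphism is orientation reversing iff it admits a strictly decreasing
degree `-1` lift. -/
def OrientationReversing (f : S1 ≃ₜ S1) : Prop :=
  ∃ F : ℝ → ℝ, StrictAnti F ∧ (∀ x : ℝ, F (x + 1) = F x - 1) ∧
    ∀ x : ℝ, f (x : S1) = ((F x : ℝ) : S1)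

/-- `f` has (Poincaré) rotation number `r` (mod 1): some lift has translation number `r`. -/
def HasRotationNumber (f : S1 ≃ₜ S1) (r : ℝ) : Prop :=
  ∃ F : CircleDeg1Lift, IsLiftOf f F ∧ F.translationNumber = r

/-- An involution. -/
def IsInvolution (f : S1 ≃ₜ S1) : Prop := ∀ x, f (f x) = x

/-- The canonical representative of a point of the circle in `[0, 1)`. -/
def rep (x : S1) : ℝ := (AddCircle.equivIco 1 0 x : ℝ)

/-- The signature of a circle homeomorphism with respect to a lift `F`; when `F` is the
(unique) lift with a fixed point of an orientation preserving homeomorphism with a fixed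
point, this is the signature function `Δ_f : S¹ → {-1, 0, 1}`. -/
def signature (F : CircleDeg1Lift) (x : S1) : ℝ := Real.sign (F (rep x) - rep x)

/-- Strong reversibility in `Homeo⁺(S¹)`. -/
def StronglyReversiblePlus (f : S1 ≃ₜ S1) : Prop :=
  ∃ σ : S1 ≃ₜ S1, OrientationPreserving σ ∧ IsInvolution σ ∧ ∀ x, σ (f (σ x)) = f.symm x

/-- Strong reversibility in the full group `Homeo(S¹)`. -/
def StronglyReversible (f : S1 ≃ₜ S1) : Prop :=
  ∃ τ : S1 ≃ₜ S1, IsInvolution τ ∧ ∀ x, τ (f (τ x)) = f.symm x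

/-- `y` is trapped between two points of the `G`-orbit of `x`. For fixed `G` this is an equivalence
relation whose classes are the fixed points of `G` and the components of their complement. -/
def OrbitHull (G : ℝ ≃o ℝ) (x y : ℝ) : Prop :=
  ∃ s t : ℤ, (G ^ s) x ≤ y ∧ y ≤ (G ^ t) x

namespace OrbitHull

variable {G : ℝ ≃o ℝ} {x y z : ℝ}

theorem refl (G : ℝ ≃o ℝ) (x : ℝ) : OrbitHull G x x :=
  ⟨0, 0, by simp, by simp⟩

theorem symm (h : OrbitHull G x y) : OrbitHull G y x := by
  obtain ⟨s, t, hs, ht⟩ := h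
  refine ⟨-t, -s, ?_, ?_⟩
  · simpa [← RelIso.mul_apply, ← zpow_add] using (G ^ (-t)).monotone ht
  · simpa [← RelIso.mul_apply, ← zpow_add] using (G ^ (-s)).monotone hs

theorem trans (h : OrbitHull G x y) (h' : OrbitHull G y z) : OrbitHull G x z := by
  obtain ⟨s, t, hs, ht⟩ := h
  obtain ⟨s', t', hs', ht'⟩ := h'
  refine ⟨s' + s, t' + t, ?_, ?_⟩
  · rw [zpow_add, RelIso.mul_apply]
    exact ((G ^ s').monotone hs).trans hs'
  · rw [zpow_add, RelIso.mul_apply]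
    exact ht'.trans ((G ^ t').monotone ht)

theorem map (P : ℝ ≃o ℝ) (hP : Commute P G) (h : OrbitHull G x y) :
    OrbitHull G (P x) (P y) := by
  obtain ⟨s, t, hs, ht⟩ := h
  refine ⟨s, t, ?_, ?_⟩
  · rw [← RelIso.mul_apply, ← (hP.zpow_right s).eq]
    exact P.monotone hs
  · rw [← RelIso.mul_apply, ← (hP.zpow_right t).eq]
    exact P.monotone ht

theorem inv_iff : OrbitHull G⁻¹ x y ↔ OrbitHull G x y := by
  constructor
  · rintro ⟨s, t, hs, ht⟩
    exact ⟨-s, -t, by simpa using hs, by simpa using ht⟩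
  · rintro ⟨s, t, hs, ht⟩
    exact ⟨-s, -t, by simpa using hs, by simpa using ht⟩

theorem zpow_apply_of_fixed (hx : G x = x) (s : ℤ) : (G ^ s) x = x := by
  have h1 : G⁻¹ x = x := by
    conv_lhs => rw [← hx]
    exact RelIso.inv_apply_self G x
  induction s with
  | zero => simp
  | succ i ih => rw [zpow_add_one, RelIso.mul_apply, hx, ih]
  | pred i ih => rw [zpow_sub_one, RelIso.mul_apply, h1, ih]

theorem eq_of_fixed (h : OrbitHull G x y) (hx : G x = x) : y = x := by
  obtain ⟨s, t, hs, ht⟩ := h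
  rw [zpow_apply_of_fixed hx] at hs ht
  exact le_antisymm ht hs

/-- Classes are order convex and pairwise disjoint, so they are ordered. -/
theorem of_crossing {x' y' : ℝ} (hx : OrbitHull G x x') (hy : OrbitHull G y y') (hxy : x ≤ y)
    (h : y' ≤ x') : OrbitHull G x y := by
  obtain ⟨-, t, -, ht⟩ := hx
  obtain ⟨-, u, -, hu⟩ := hy.symm
  refine ⟨0, u + t, by simpa using hxy, ?_⟩
  rw [zpow_add, RelIso.mul_apply]
  exact hu.trans ((G ^ u).monotone (h.trans ht))

end OrbitHull

theorem strictMono_zpow_apply {G : ℝ ≃o ℝ} {c : ℝ} (hc : c < G c) :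
    StrictMono fun s : ℤ => (G ^ s) c := by
  refine strictMono_int_of_lt_succ fun s => ?_
  rw [zpow_add_one, RelIso.mul_apply]
  exact (G ^ s).strictMono hc

theorem exists_strictMono_param {G : ℝ ≃o ℝ} {c : ℝ} (hc : c < G c) :
    ∃ E : ℝ → ℝ, StrictMono E ∧ (∀ t, E (t + 1) = G (E t)) ∧
      ∀ x, OrbitHull G c x ↔ ∃ t, E t = x := by
  have hpos : 0 < G c - c := sub_pos.2 hc
  have hmono := strictMono_zpow_apply hc
  let e : ℝ → ℝ := fun r => c + r * (G c - c)
  have he : StrictMono e := fun a b hab => by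
    simpa [e] using mul_lt_mul_of_pos_right hab hpos
  have he0 : e 0 = c := by simp [e]
  have he1 : e 1 = G c := by simp [e]
  let E : ℝ → ℝ := fun t => (G ^ ⌊t⌋) (e (Int.fract t))
  have hlow : ∀ t, (G ^ ⌊t⌋) c ≤ E t := fun t =>
    (G ^ ⌊t⌋).monotone (he0 ▸ he.monotone (Int.fract_nonneg t))
  have hup : ∀ t, E t < (G ^ (⌊t⌋ + 1)) c := fun t => by
    rw [zpow_add_one, RelIso.mul_apply]
    exact (G ^ ⌊t⌋).strictMono (he1 ▸ he (Int.fract_lt_one t))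
  refine ⟨E, ?_, ?_, ?_⟩
  · intro a b hab
    rcases (Int.floor_mono hab.le).eq_or_lt with h | h
    · change (G ^ ⌊a⌋) _ < (G ^ ⌊b⌋) _
      rw [← h]
      refine (G ^ ⌊a⌋).strictMono (he ?_)
      rw [Int.fract, Int.fract, ← h]
      linarith
    · exact (hup a).trans_le ((hmono.monotone (Int.add_one_le_iff.2 h)).trans (hlow b))
  · intro t
    change (G ^ ⌊t + 1⌋) _ = G ((G ^ ⌊t⌋) _)
    rw [Int.floor_add_one, Int.fract_add_one, add_comm, zpow_add, zpow_one, RelIso.mul_apply]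
  · intro x
    constructor
    · rintro ⟨a, b, ha, hb⟩
      obtain ⟨s, hs, hs'⟩ := Int.exists_greatest_of_bdd (P := fun s => (G ^ s) c ≤ x)
        ⟨b, fun z hz => hmono.le_iff_le.1 (hz.trans hb)⟩ ⟨a, ha⟩
      have hs1 : x < (G ^ (s + 1)) c := by
        by_contra! h
        exact absurd (hs' _ h) (by lia)
      set y := (G ^ (-s)) x with hy
      have hyx : (G ^ s) y = x := by simp [hy, ← RelIso.mul_apply]
      have hy0 : c ≤ y := by
        rw [← hyx] at hs
        exact (G ^ s).le_iff_le.1 hs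
      have hy1 : y < G c := by
        rw [← hyx, zpow_add_one, RelIso.mul_apply] at hs1
        exact (G ^ s).lt_iff_lt.1 hs1
      set r := (y - c) / (G c - c) with hr
      have hr0 : 0 ≤ r := div_nonneg (by linarith) hpos.le
      have hr1 : r < 1 := (div_lt_one hpos).2 (by linarith)
      have her : e r = y := by
        simp only [e, hr]
        field_simp
        ring
      have hfl : ⌊(s : ℝ) + r⌋ = s := by
        rw [Int.floor_eq_iff]
        constructor <;> linarith
      refine ⟨s + r, ?_⟩
      change (G ^ ⌊(s : ℝ) + r⌋) (e (Int.fract ((s : ℝ) + r))) = x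
      rw [Int.fract, hfl, add_sub_cancel_left, her, hyx]
    · rintro ⟨t, rfl⟩
      exact ⟨_, _, hlow t, (hup t).le⟩

theorem exists_param {G : ℝ ≃o ℝ} {c : ℝ} (hc : G c ≠ c) :
    ∃ E : ℝ → ℝ, (StrictMono E ∨ StrictAnti E) ∧ (∀ t, E (t + 1) = G (E t)) ∧
      ∀ x, OrbitHull G c x ↔ ∃ t, E t = x := by
  rcases hc.lt_or_gt with h | h
  · have h' : c < G⁻¹ c := by
      simpa using (G⁻¹).strictMono h
    obtain ⟨E, hE, hE1, hE2⟩ := exists_strictMono_param h'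
    refine ⟨fun t => E (-t), Or.inr fun a b hab => hE (neg_lt_neg hab), fun t => ?_, fun x => ?_⟩
    · have := hE1 (-(t + 1))
      rw [show -(t + 1) + 1 = -t by ring] at this
      simp [this]
    · rw [← OrbitHull.inv_iff, hE2]
      exact ⟨fun ⟨t, ht⟩ => ⟨-t, by simpa using ht⟩, fun ⟨t, ht⟩ => ⟨-t, ht⟩⟩
  · obtain ⟨E, hE, h⟩ := exists_strictMono_param h
    exact ⟨E, Or.inl hE, h⟩

section Conjugacy

variable {Γ : Type*} [CommGroup Γ] (w : Γ →* (ℝ ≃o ℝ)) (g : Γ)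

theorem commute_action (γ δ : Γ) : Commute (w γ) (w δ) :=
  (Commute.all γ δ).map w

theorem action_fixed_iff (γ : Γ) (x : ℝ) : w g (w γ x) = w γ x ↔ w g x = x := by
  rw [← RelIso.mul_apply, (commute_action w g γ).eq, RelIso.mul_apply, (w γ).injective.eq_iff]

/-- Points whose `Γ`-orbits meet the same class of `OrbitHull (w g)`. -/
def orbitSetoid : Setoid ℝ where
  r x y := ∃ γ, OrbitHull (w g) (w γ x) y
  iseqv :=
    { refl := fun x => ⟨1, by simpa using OrbitHull.refl (w g) x⟩
      symm := by
        rintro x y ⟨γ, h⟩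
        refine ⟨γ⁻¹, ?_⟩
        simpa using h.symm.map (w γ⁻¹) (commute_action w _ _)
      trans := by
        rintro x y z ⟨γ, h⟩ ⟨δ, h'⟩
        refine ⟨δ * γ, ?_⟩
        rw [map_mul, RelIso.mul_apply]
        exact (h.map (w δ) (commute_action w _ _)).trans h' }

/-- Parametrisations of the classes of `OrbitHull (w g)` in which `w g` becomes the unit
translation, chosen constant along `Γ`-orbits. -/
theorem exists_equivariant_param :
    ∃ E : ℝ → ℝ → ℝ, (∀ x y γ, OrbitHull (w g) (w γ x) y → E y = E x) ∧
      ∀ x, w g x ≠ x → (StrictMono (E x) ∨ StrictAnti (E x)) ∧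
        (∀ t, E x (t + 1) = w g (E x t)) ∧
        (∃ γ t, w γ x = E x t) ∧
        (∀ t t', OrbitHull (w g) (E x t) (E x t')) ∧
        ∀ t y, OrbitHull (w g) (E x t) y → ∃ t', y = E x t' := by
  choose! E hE using fun (c : ℝ) (hc : w g c ≠ c) => exists_param hc
  let c : ℝ → ℝ := fun x => (Quotient.mk (orbitSetoid w g) x).out
  have hc : ∀ x, ∃ γ, OrbitHull (w g) (w γ x) (c x) := fun x =>
    (orbitSetoid w g).symm (Quotient.mk_out (s := orbitSetoid w g) x)
  refine ⟨fun x => E (c x), ?_, ?_⟩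
  · intro x y γ h
    have : c x = c y := congrArg Quotient.out (Quotient.sound (s := orbitSetoid w g) ⟨γ, h⟩)
    simp only [this]
  · intro x hx
    obtain ⟨γ, hγ⟩ := hc x
    have hcx : w g (c x) ≠ c x := fun h => by
      have := hγ.symm.eq_of_fixed h
      rw [← this, action_fixed_iff] at h
      exact hx h
    obtain ⟨h1, h2, h3⟩ := hE (c x) hcx
    refine ⟨h1, h2, ?_, fun t t' => ((h3 _).2 ⟨t, rfl⟩).symm.trans ((h3 _).2 ⟨t', rfl⟩), ?_⟩
    · obtain ⟨t, ht⟩ := (h3 _).1 hγ.symm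
      exact ⟨γ, t, ht.symm⟩
    · intro t y h
      obtain ⟨t', ht'⟩ := (h3 y).1 (((h3 _).2 ⟨t, rfl⟩).trans h)
      exact ⟨t', ht'.symm⟩

theorem param_add_int {G : ℝ ≃o ℝ} {E : ℝ → ℝ} (h : ∀ t, E (t + 1) = G (E t)) (t : ℝ) (s : ℤ) :
    E (t + s) = (G ^ s) (E t) := by
  induction s with
  | zero => simp
  | succ i ih =>
    rw [add_comm (i : ℤ) 1, zpow_add, zpow_one, RelIso.mul_apply, ← ih, ← h]
    push_cast
    ring_nf
  | pred i ih =>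
    apply G.injective
    rw [← h, ← RelIso.mul_apply, ← zpow_one_add, add_sub_cancel, ← ih]
    push_cast
    ring_nf

/-- If the stabiliser in `Γ` of each class is generated by `g`, then the action `w` is conjugate to
the action obtained by speeding up each `γ` by `k * χ γ` iterates of `g`. -/
theorem exists_conj_speedup (χ : Γ →* Multiplicative ℤ) (n : ℕ)
    (hχ : (χ g).toAdd = n)
    (hstab : ∀ γ x, OrbitHull (w g) x (w γ x) → ∃ s : ℤ, γ = g ^ s) (k : ℕ) :
    ∃ H : ℝ ≃o ℝ, ∀ γ x, H (w γ x) = w (γ * g ^ ((k : ℤ) * (χ γ).toAdd)) (H x) := by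
  obtain ⟨E, hEeq, hE⟩ := exists_equivariant_param w g
  have hEw : ∀ γ x, E (w γ x) = E x := fun γ x => hEeq x _ γ (OrbitHull.refl _ _)
  have hEh : ∀ {x y}, OrbitHull (w g) x y → E y = E x := fun {x y} h =>
    hEeq x y 1 (by simpa using h)
  have hinj : ∀ x, w g x ≠ x → Function.Injective (E x) := fun x hx =>
    (hE x hx).1.elim StrictMono.injective StrictAnti.injective
  set m : ℝ := 1 + n * k with hm
  have hmpos : 0 < m := by positivity
  choose! γ₀ t₀ h₀ using fun x hx => (hE x hx).2.2.1
  let H : ℝ → ℝ := fun x => if w g x = x then x else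
    (w (γ₀ x))⁻¹ (E x (m * t₀ x - k * (χ (γ₀ x)).toAdd))
  have Hfix : ∀ x, w g x = x → H x = x := fun x hx => if_pos hx
  have Hspec : ∀ x, w g x ≠ x → ∀ γ t, w γ x = E x t →
      w γ (H x) = E x (m * t - k * (χ γ).toAdd) := by
    intro x hx γ t h
    have hH : w (γ₀ x) (H x) = E x (m * t₀ x - k * (χ (γ₀ x)).toAdd) := by
      simp only [H, if_neg hx, RelIso.apply_inv_self]
    have hdiv : w (γ / γ₀ x) (E x (t₀ x)) = E x t := by
      rw [← h₀ x hx, ← RelIso.mul_apply, ← map_mul, div_mul_cancel, h]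
    obtain ⟨s, hs⟩ := hstab (γ / γ₀ x) (E x (t₀ x)) (hdiv ▸ (hE x hx).2.2.2.1 _ _)
    have ht : t = t₀ x + s := by
      apply hinj x hx
      rw [param_add_int (hE x hx).2.1, ← hdiv, hs, map_zpow]
    have hγ : γ = g ^ s * γ₀ x := by rw [← hs, div_mul_cancel]
    rw [hγ, map_mul, RelIso.mul_apply, hH, map_zpow, ← param_add_int (hE x hx).2.1, ht]
    congr 1
    simp only [map_mul, map_zpow, toAdd_mul, toAdd_zpow, hχ, hm, smul_eq_mul]
    push_cast
    ring
  have Hhull : ∀ x, OrbitHull (w g) x (H x) := by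
    intro x
    by_cases hx : w g x = x
    · rw [Hfix x hx]
      exact OrbitHull.refl _ _
    · have h1 := Hspec x hx _ _ (h₀ x hx)
      have h2 : OrbitHull (w g) (w (γ₀ x) x) (w (γ₀ x) (H x)) := by
        rw [h1, h₀ x hx]
        exact (hE x hx).2.2.2.1 _ _
      simpa using h2.map (w (γ₀ x))⁻¹ ((commute_action w _ _).inv_left)
  have Hmono : StrictMono H := by
    intro x y hxy
    by_contra! hle
    have hh := OrbitHull.of_crossing (Hhull x) (Hhull y) hxy.le hle
    have hx : w g x ≠ x := fun hx => hxy.ne' (hh.eq_of_fixed hx)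
    have hy : w g y ≠ y := fun hy => hxy.ne (hh.symm.eq_of_fixed hy)
    have hEy : E y = E x := hEh hh
    have h1 := h₀ x hx
    obtain ⟨t, ht⟩ := (hE x hx).2.2.2.2 (t₀ x) (w (γ₀ x) y)
      (h1 ▸ hh.map (w (γ₀ x)) (commute_action w _ _))
    have h3 := Hspec x hx _ _ h1
    have h4 := Hspec y hy (γ₀ x) t (by rw [hEy, ht])
    have h5 := (w (γ₀ x)).strictMono hxy
    have h6 := (w (γ₀ x)).monotone hle
    rw [h1, ht] at h5
    rw [h3, h4, hEy] at h6
    rcases (hE x hx).1 with hE' | hE'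
    · have := mul_lt_mul_of_pos_left (hE'.lt_iff_lt.1 h5) hmpos
      have := hE'.le_iff_le.1 h6
      linarith
    · have := mul_lt_mul_of_pos_left (hE'.lt_iff_gt.1 h5) hmpos
      have := hE'.le_iff_ge.1 h6
      linarith
  have Hsurj : Function.Surjective H := by
    intro y
    by_cases hy : w g y = y
    · exact ⟨y, Hfix y hy⟩
    · have h1 := h₀ y hy
      set u := (t₀ y + k * (χ (γ₀ y)).toAdd) / m with hu
      set x := (w (γ₀ y))⁻¹ (E y u) with hx
      have hwx : w (γ₀ y) x = E y u := by simp [hx]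
      have hyx : OrbitHull (w g) (w (γ₀ y) y) (w (γ₀ y) x) := by
        rw [h1, hwx]
        exact (hE y hy).2.2.2.1 _ _
      have hyx' : OrbitHull (w g) y x := by
        simpa using hyx.map (w (γ₀ y))⁻¹ ((commute_action w _ _).inv_left)
      have hEx : E x = E y := hEh hyx'
      have hxf : w g x ≠ x := fun h => hy (by rwa [hyx'.symm.eq_of_fixed h])
      refine ⟨x, (w (γ₀ y)).injective ?_⟩
      rw [Hspec x hxf (γ₀ y) u (by rw [hEx, hwx]), h1, hEx, hu]
      congr 1
      field_simp
      ring
  refine ⟨StrictMono.orderIsoOfSurjective H Hmono Hsurj, fun δ x => ?_⟩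
  simp only [StrictMono.coe_orderIsoOfSurjective]
  by_cases hx : w g x = x
  · rw [Hfix x hx, Hfix _ ((action_fixed_iff w g δ x).2 hx), map_mul, RelIso.mul_apply, map_zpow,
      OrbitHull.zpow_apply_of_fixed hx]
  · have hx' : w g (w δ x) ≠ w δ x := fun h => hx ((action_fixed_iff w g δ x).1 h)
    have h1 := Hspec x hx _ _ (h₀ x hx)
    have h2 := Hspec _ hx' (γ₀ x / δ) (t₀ x) (by
      rw [← RelIso.mul_apply, ← map_mul, div_mul_cancel, hEw, h₀ x hx])
    apply (w (γ₀ x / δ)).injective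
    rw [h2, hEw, ← RelIso.mul_apply, ← map_mul, ← mul_assoc, div_mul_cancel, mul_comm (γ₀ x), map_mul,
      RelIso.mul_apply, h1, map_zpow, ← param_add_int (hE x hx).2.1]
    congr 1
    simp only [map_div, toAdd_div]
    push_cast
    ring

end Conjugacy

theorem S1.coe_eq_coe_iff (x y : ℝ) : (x : S1) = (y : S1) ↔ ∃ k : ℤ, y = x + k := by
  rw [eq_comm, ← sub_eq_zero, ← AddCircle.coe_sub, AddCircle.coe_eq_zero_iff]
  refine exists_congr fun k => ?_
  rw [zsmul_one, eq_comm, sub_eq_iff_eq_add']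

theorem S1.coe_add_intCast (x : ℝ) (k : ℤ) : ((x + k : ℝ) : S1) = (x : S1) :=
  ((S1.coe_eq_coe_iff x (x + k)).2 ⟨k, rfl⟩).symm

namespace IsLiftOf

variable {f : S1 ≃ₜ S1} {F : CircleDeg1Lift}

theorem bijective (h : IsLiftOf f F) : Function.Bijective F := by
  constructor
  · intro x y hxy
    have hxy' : (x : S1) = y := f.injective (by rw [h, h, hxy])
    obtain ⟨k, rfl⟩ := (S1.coe_eq_coe_iff x y).1 hxy'
    rw [F.map_add_int] at hxy
    linarith
  · intro y
    obtain ⟨x, hx⟩ := QuotientAddGroup.mk_surjective (f.symm (y : S1))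
    have hy : ((F x : ℝ) : S1) = y := by
      rw [← h]
      exact (congrArg f hx).trans (f.apply_symm_apply _)
    obtain ⟨k, rfl⟩ := (S1.coe_eq_coe_iff _ _).1 hy
    exact ⟨x + k, F.map_add_int x k⟩

theorem iterate (h : IsLiftOf f F) (m : ℕ) (x : ℝ) :
    (⇑f)^[m] (x : S1) = (((F ^ m) x : ℝ) : S1) := by
  rw [CircleDeg1Lift.coe_pow]
  have hs : Function.Semiconj ((↑) : ℝ → S1) F f := fun y => (h y).symm
  exact (hs.iterate_right m x).symm

end IsLiftOf

theorem exists_homeomorph_of_orderIso (H : ℝ ≃o ℝ) (hH : ∀ x, H (x + 1) = H x + 1) :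
    ∃ h : S1 ≃ₜ S1, ∀ x : ℝ, h (x : S1) = ((H x : ℝ) : S1) := by
  have hH' : ∀ x, H.symm (x + 1) = H.symm x + 1 := fun x => by
    rw [OrderIso.symm_apply_eq, hH, H.apply_symm_apply]
  have descend : ∀ K : ℝ ≃o ℝ, (∀ x, K (x + 1) = K x + 1) →
      ∃ h : S1 → S1, Continuous h ∧ ∀ x : ℝ, h (x : S1) = ((K x : ℝ) : S1) := by
    intro K hK
    have hper : Function.Periodic (fun x : ℝ => ((K x : ℝ) : S1)) 1 := fun x => by
      simp only [hK, AddCircle.coe_add_period]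
    exact ⟨hper.lift, continuous_coinduced_dom.2
      ((AddCircle.continuous_mk' 1).comp K.continuous), fun x => rfl⟩
  obtain ⟨h, hc, hh⟩ := descend H hH
  obtain ⟨h', hc', hh'⟩ := descend H.symm hH'
  refine ⟨⟨⟨h, h', ?_, ?_⟩, hc, hc'⟩, hh⟩
  · intro x
    induction x using QuotientAddGroup.induction_on with
    | H x => exact (congrArg h' (hh x)).trans ((hh' _).trans (by simp))
  · intro x
    induction x using QuotientAddGroup.induction_on with
    | H x => exact (congrArg h (hh' x)).trans ((hh _).trans (by simp))

namespace CircleDeg1Lift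

open Multiplicative

theorem translationNumber_eq_zero_of_orbitHull {P G : CircleDeg1Liftˣ} (hPG : Commute P G)
    (hG : translationNumber G = 0) {x : ℝ}
    (h : OrbitHull (toOrderIso G) x (toOrderIso P x)) : translationNumber P = 0 := by
  have key : ∀ t : ℤ, translationNumber ((G ^ (-t) * P : CircleDeg1Liftˣ) : CircleDeg1Lift) =
      translationNumber P := fun t => by
    rw [Units.val_mul, translationNumber_mul_of_commute (hPG.symm.zpow_left _).units_val,
      translationNumber_zpow, hG, mul_zero, zero_add]
  have cancel : ∀ t : ℤ, (toOrderIso G ^ (-t)) ((toOrderIso G ^ t) x) = x := fun t => by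
    rw [← RelIso.mul_apply, ← zpow_add, neg_add_cancel, zpow_zero, RelIso.one_apply]
  have eval : ∀ t : ℤ, (G ^ (-t) * P : CircleDeg1Liftˣ) x =
      (toOrderIso G ^ (-t)) (toOrderIso P x) := fun t => by
    rw [← map_zpow, ← RelIso.mul_apply, ← map_mul, coe_toOrderIso]
  obtain ⟨s, t, hs, ht⟩ := h
  apply le_antisymm
  · have h1 := (toOrderIso G ^ (-t)).monotone ht
    rw [cancel, ← eval] at h1
    have := translationNumber_le_of_le_add_int _ (m := 0) (h1.trans (by simp))
    rwa [key, Int.cast_zero] at this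
  · have h1 := (toOrderIso G ^ (-s)).monotone hs
    rw [cancel, ← eval] at h1
    have := le_translationNumber_of_add_int_le _ (m := 0) (le_trans (by simp) h1)
    rwa [key, Int.cast_zero] at this

theorem commute_translate_one (U : CircleDeg1Liftˣ) : Commute U (translate (ofAdd 1)) := by
  refine Units.ext (CircleDeg1Lift.ext fun x => ?_)
  simp [translate_apply]

theorem translate_one_zpow_apply (l : ℤ) (x : ℝ) :
    (translate (ofAdd 1) ^ l : CircleDeg1Liftˣ) x = x + l := by
  rw [translate_zpow, translate_apply, mul_one, add_comm]

/-- The action of `ℤ × ℤ` on the line generated by `U` and the unit translation. -/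
def latticeAction (U : CircleDeg1Liftˣ) :
    Multiplicative ℤ × Multiplicative ℤ →* CircleDeg1Liftˣ :=
  (zpowersHom _ U).noncommCoprod (zpowersHom _ (translate (ofAdd 1))) fun a b => by
    simpa using ((commute_translate_one U).zpow_zpow a.toAdd b.toAdd)

theorem latticeAction_apply (U : CircleDeg1Liftˣ) (i l : ℤ) :
    latticeAction U (ofAdd i, ofAdd l) = U ^ i * translate (ofAdd 1) ^ l := by
  simp [latticeAction]

theorem latticeAction_apply_apply (U : CircleDeg1Liftˣ) (i l : ℤ) (x : ℝ) :
    latticeAction U (ofAdd i, ofAdd l) x = (U ^ i : CircleDeg1Liftˣ) x + l := by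
  rw [latticeAction_apply, Units.val_mul, mul_apply, translate_one_zpow_apply, map_add_int]

theorem translationNumber_latticeAction (U : CircleDeg1Liftˣ) (i l : ℤ) :
    translationNumber (latticeAction U (ofAdd i, ofAdd l)) = i * translationNumber U + l := by
  rw [latticeAction_apply, Units.val_mul, translationNumber_mul_of_commute
    ((commute_translate_one U).zpow_zpow i l).units_val, translationNumber_zpow, translate_zpow,
    translationNumber_translate, mul_one]

/-- A lift with translation number `p / n` in lowest terms is conjugate to its composition with
powers of the iterate `U ^ n - p`, which has fixed points. -/
theorem exists_conj_mul_pow {U : CircleDeg1Liftˣ} {n : ℕ} (hn : 0 < n) {p : ℤ}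
    (hp : IsCoprime p n) (hU : n * translationNumber U = p) (k : ℕ) :
    ∃ H : ℝ ≃o ℝ, (∀ x, H (x + 1) = H x + 1) ∧
      ∀ x, H (U x) = ((U : CircleDeg1Lift) ^ (1 + n * k)) (H x) + ((-(p * k) : ℤ) : ℝ) := by
  let g : Multiplicative ℤ × Multiplicative ℤ := (ofAdd (n : ℤ), ofAdd (-p))
  have hn' : (n : ℤ) ≠ 0 := by exact_mod_cast hn.ne'
  have hg : translationNumber (latticeAction U g) = 0 := by
    rw [translationNumber_latticeAction]
    push_cast
    linarith
  obtain ⟨H, hH⟩ := exists_conj_speedup (toOrderIso.comp (latticeAction U)) g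
    (MonoidHom.fst _ _) n rfl (by
      rintro ⟨i, l⟩ x h
      have h0 := translationNumber_eq_zero_of_orbitHull ((Commute.all _ g).map _) hg h
      obtain ⟨i, rfl⟩ := ofAdd.surjective i
      obtain ⟨l, rfl⟩ := ofAdd.surjective l
      rw [translationNumber_latticeAction] at h0
      have h1 : i * p + n * l = 0 := by
        have : (i : ℝ) * p + n * l = 0 := by
          rw [← hU]
          linear_combination (n : ℝ) * h0
        exact_mod_cast this
      obtain ⟨s, rfl⟩ : (n : ℤ) ∣ i :=
        hp.symm.dvd_of_dvd_mul_right ⟨-l, by linear_combination h1⟩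
      refine ⟨s, ?_⟩
      have h2 : l = -(s * p) := mul_left_cancel₀ hn' (by linear_combination h1)
      simp only [g, Prod.pow_mk, ← ofAdd_zsmul, h2, smul_eq_mul]
      ring_nf) k
  refine ⟨H, fun x => ?_, fun x => ?_⟩
  · have := hH (ofAdd 0, ofAdd 1) x
    simp only [MonoidHom.coe_fst, toAdd_ofAdd, mul_zero, zpow_zero, mul_one, MonoidHom.comp_apply,
      coe_toOrderIso, latticeAction_apply_apply] at this
    simpa using this
  · have := hH (ofAdd 1, ofAdd 0) x
    have hz : ((ofAdd 1, ofAdd 0) : Multiplicative ℤ × Multiplicative ℤ) * g ^ (k : ℤ) =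
        (ofAdd ((1 + n * k : ℕ) : ℤ), ofAdd (-(p * k))) := by
      simp only [g, Prod.pow_mk, ← ofAdd_zsmul, Prod.mk_mul_mk, ← ofAdd_add, smul_eq_mul]
      push_cast
      ring_nf
    simp only [MonoidHom.coe_fst, toAdd_ofAdd, mul_one] at this
    rw [hz] at this
    simp only [MonoidHom.comp_apply, coe_toOrderIso, latticeAction_apply_apply, zpow_natCast,
      Units.val_pow_eq_pow_val] at this
    simpa using this

end CircleDeg1Lift

/-- `f` is conjugate to those of its powers that have the same rotation number. -/
theorem exists_homeomorph_conj_iterate (f : S1 ≃ₜ S1) (hf : OrientationPreserving f) (n : ℕ)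
    (hn : 0 < n) (hper : ∃ x, (⇑f)^[n] x = x)
    (hmin : ∀ m : ℕ, 0 < m → m < n → ¬∃ x, (⇑f)^[m] x = x) (k : ℕ) :
    ∃ h : S1 ≃ₜ S1, ∀ x, h (f x) = (⇑f)^[1 + n * k] (h x) := by
  obtain ⟨F, hF⟩ := hf
  obtain ⟨U, rfl⟩ := CircleDeg1Lift.isUnit_iff_bijective.2 hF.bijective
  obtain ⟨x₀, hx₀⟩ := hper
  obtain ⟨x₀, rfl⟩ := QuotientAddGroup.mk_surjective x₀
  obtain ⟨p, hp⟩ := (S1.coe_eq_coe_iff _ _).1 ((hF.iterate n x₀).symm.trans hx₀).symm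
  have hτ : n * CircleDeg1Lift.translationNumber U = p := by
    rw [← CircleDeg1Lift.translationNumber_pow]
    exact CircleDeg1Lift.translationNumber_of_eq_add_int _ hp
  have hcont : Continuous (U : CircleDeg1Lift) :=
    (CircleDeg1Lift.continuous_iff_surjective _).2 hF.bijective.2
  have hcop : IsCoprime p n := by
    rw [Int.isCoprime_iff_gcd_eq_one]
    obtain ⟨p', hp'⟩ := Int.gcd_dvd_left p n
    obtain ⟨n', hn'⟩ : Int.gcd p n ∣ n := by exact_mod_cast Int.gcd_dvd_right p n
    set q := Int.gcd p n
    have hn'0 : 0 < n' := Nat.pos_of_ne_zero fun h => by simp [h] at hn'; omega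
    have hq0 : 0 < q := Nat.pos_of_ne_zero fun h => by simp [h] at hn'; omega
    have hτ' : CircleDeg1Lift.translationNumber ((U : CircleDeg1Lift) ^ n') = p' := by
      have hq : (q : ℝ) ≠ 0 := by exact_mod_cast hq0.ne'
      rw [CircleDeg1Lift.translationNumber_pow]
      apply mul_left_cancel₀ hq
      rw [← mul_assoc, ← Nat.cast_mul, ← hn', hτ, hp']
      push_cast
      ring
    obtain ⟨y, hy⟩ := (CircleDeg1Lift.translationNumber_eq_int_iff _
      (CircleDeg1Lift.continuous_pow _ hcont n')).1 hτ'
    have hle : n ≤ n' := not_lt.1 fun hlt => hmin n' hn'0 hlt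
      ⟨y, by rw [hF.iterate, hy, S1.coe_add_intCast]⟩
    have : q * n' ≤ 1 * n' := by rw [← hn', one_mul]; exact hle
    exact le_antisymm (Nat.le_of_mul_le_mul_right this hn'0) hq0
  obtain ⟨H, hH1, hH⟩ := CircleDeg1Lift.exists_conj_mul_pow hn hcop hτ k
  obtain ⟨h, hh⟩ := exists_homeomorph_of_orderIso H hH1
  refine ⟨h, fun x => ?_⟩
  obtain ⟨x, rfl⟩ := QuotientAddGroup.mk_surjective x
  rw [hF, hh, hh, hF.iterate, hH, S1.coe_add_intCast]

/-- If `f` is orientation preserving with minimal period `n` and `f^d` is strongly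
reversible for some `d ∈ {1, …, n-1}` coprime to `n`, then `f` is strongly reversible. -/
theorem stmt16 (f : S1 ≃ₜ S1) (hf : OrientationPreserving f) (n : ℕ) (hn : 0 < n)
    (hper : ∃ x, (⇑f)^[n] x = x)
    (hmin : ∀ m : ℕ, 0 < m → m < n → ¬∃ x, (⇑f)^[m] x = x)
    (d : ℕ) (hd1 : 0 < d) (hdn : d < n) (hcop : Nat.Coprime d n)
    (hrev : ∃ τ : S1 ≃ₜ S1, IsInvolution τ ∧
      ∀ x, τ ((⇑f)^[d] (τ x)) = (⇑f.symm)^[d] x) :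
    StronglyReversible f := by
  obtain ⟨τ, hτ, hrev⟩ := hrev
  obtain ⟨u, -, hu⟩ := Nat.exists_mul_mod_eq_one_of_coprime hcop (by omega)
  have hdu : d * u = 1 + n * (d * u / n) := by
    conv_lhs => rw [← Nat.mod_add_div (d * u) n, hu]
  obtain ⟨h, hh⟩ := exists_homeomorph_conj_iterate f hf n hn hper hmin (d * u / n)
  rw [← hdu] at hh
  have hτu : Function.Semiconj τ ((⇑f)^[d * u]) ((⇑f.symm)^[d * u]) := by
    rw [Function.iterate_mul, Function.iterate_mul]
    refine Function.Semiconj.iterate_right (fun x => ?_) u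
    rw [← hrev, hτ]
  have hsymm : Function.Semiconj h.symm ((⇑f.symm)^[d * u]) f.symm := fun x => by
    apply f.injective
    apply h.injective
    rw [f.apply_symm_apply, hh, h.apply_symm_apply, h.apply_symm_apply]
    exact Function.LeftInverse.iterate f.apply_symm_apply (d * u) x
  refine ⟨(h.trans τ).trans h.symm, fun x => ?_, fun x => ?_⟩
  · simp [hτ _]
  · simp only [Homeomorph.trans_apply]
    rw [hh, h.apply_symm_apply, hτu, hτ, hsymm, h.symm_apply_apply]
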